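/- arXiv:1306.1447 — 5 statements merged into one kernel-verified Lean document; each statement's English description precedes it below -/
import Mathlib

section
/- Let A be an alphabet, P ⊆ A* a prefix code, and p₀ ∈ P. Define the total function π : A* → A* by π(x) = x if x ∈ (P∖{p₀})·A*, and π(x) = p₀x otherwise; and define the partial function π' : A* ⇀ A* by π'(x) = x if x ∈ (P∖{p₀})·A*, π'(p₀z) = z for x = p₀z ∈ p₀·A*, and π'(x) undefined if x ∉ P·A*. Then π is total and injective, Im(π) = (P∖{p₀})·A* ∪ p₀·(p₀·A* ∪ (A*∖P·A*)), and π' ∘ π = id_{A*}. -/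
namespace Stmt6

variable {A : Type*}

/-- `P` is a prefix code: no element of `P` is a proper prefix of another. -/
def IsPrefixCode (P : Set (List A)) : Prop := ∀ p ∈ P, ∀ q ∈ P, p <+: q → p = q

/-- The right ideal `P·A*` generated by `P`. -/
def rIdeal (P : Set (List A)) : Set (List A) := {x | ∃ p ∈ P, ∃ w : List A, x = p ++ w}

/-- For a prefix code, the words outside `(P∖{p₀})·A*` are those in `p₀·A*` or outside `P·A*`. -/
theorem compl_rIdeal_diff_singleton {P : Set (List A)} (hP : IsPrefixCode P) {p₀ : List A}
    (hp₀ : p₀ ∈ P) : (rIdeal (P \ {p₀}))ᶜ = rIdeal {p₀} ∪ (rIdeal P)ᶜ := by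
  ext x
  constructor
  · intro hx
    by_cases h : x ∈ rIdeal P
    · obtain ⟨p, hp, w, rfl⟩ := h
      by_cases hpp : p = p₀
      · exact Or.inl ⟨p, hpp, w, rfl⟩
      · exact absurd ⟨p, ⟨hp, hpp⟩, w, rfl⟩ hx
    · exact Or.inr h
  · rintro (⟨_, rfl, w, rfl⟩ | h) ⟨q, ⟨hq, hne⟩, v, hv⟩
    · rcases List.prefix_or_prefix_of_prefix (List.prefix_append _ w) ⟨v, hv.symm⟩ with h | h
      · exact hne (hP _ hp₀ _ hq h).symm
      · exact hne (hP _ hq _ hp₀ h)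
    · exact h ⟨q, hq, v, hv⟩

/-- For a prefix code `P` and `p₀ ∈ P`: the map `π` (identity on `(P∖{p₀})·A*`,
prepending `p₀` elsewhere) is total and injective, its image is
`(P∖{p₀})·A* ∪ p₀·(p₀·A* ∪ (A*∖P·A*))`, and `π' ∘ π = id`. -/
theorem pi_properties (P : Set (List A)) (hP : IsPrefixCode P) (p₀ : List A) (hp₀ : p₀ ∈ P)
    (π : List A → List A) (π' : List A → Option (List A))
    (hπ₁ : ∀ x ∈ rIdeal (P \ {p₀}), π x = x)
    (hπ₂ : ∀ x ∉ rIdeal (P \ {p₀}), π x = p₀ ++ x)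
    (hπ'₁ : ∀ x ∈ rIdeal (P \ {p₀}), π' x = some x)
    (hπ'₂ : ∀ z : List A, π' (p₀ ++ z) = some z)
    (hπ'₃ : ∀ x ∉ rIdeal P, π' x = none) :
    Function.Injective π ∧
    Set.range π =
      rIdeal (P \ {p₀}) ∪
        (fun y => p₀ ++ y) '' (rIdeal {p₀} ∪ (rIdeal P)ᶜ) ∧
    ∀ x, π' (π x) = some x := by
  have hinv : ∀ x, π' (π x) = some x := by
    intro x
    by_cases hx : x ∈ rIdeal (P \ {p₀})
    · rw [hπ₁ x hx, hπ'₁ x hx]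
    · rw [hπ₂ x hx, hπ'₂]
  refine ⟨fun x y hxy => Option.some.inj ?_, ?_, hinv⟩
  · rw [← hinv x, ← hinv y, hxy]
  · rw [← compl_rIdeal_diff_singleton hP hp₀]
    ext y
    constructor
    · rintro ⟨x, rfl⟩
      by_cases hx : x ∈ rIdeal (P \ {p₀})
      · exact Or.inl ((hπ₁ x hx).symm ▸ hx)
      · exact Or.inr ⟨x, hx, (hπ₂ x hx).symm⟩
    · rintro (hy | ⟨x, hx, rfl⟩)
      · exact ⟨y, hπ₁ y hy⟩
      · exact ⟨x, hπ₂ x hx⟩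

end Stmt6
end

section
/- Let f : {0,1}* ⇀ {0,1}* be a partial function and let f_# be the partial function on {0,1,#}* defined by f_#(x#w) = f(x)#w for x ∈ Dom(f) and w ∈ {0,1,#}* (undefined elsewhere). If G is a right ideal morphism of {0,1,#}* satisfying f_# ∘ G ∘ f_# = f_#, then there exists a partial function g : {0,1}* ⇀ {0,1}* such that f ∘ g ∘ f = f and G(y#w) = g(y)#w for all y ∈ Im(f) and all w ∈ {0,1,#}*. -/
namespace Stmt10

/-- The three-letter alphabet {0, 1, #}. -/
inductive Letter3 : Type
  | zero : Letter3
  | one : Letter3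
  | hash : Letter3
  deriving DecidableEq

/-- Embedding of {0,1}* into {0,1,#}*. -/
def embed (x : List Bool) : List Letter3 :=
  x.map (fun b => if b then Letter3.one else Letter3.zero)

/-- Composition of partial functions: `pcomp g f` is `g ∘ f` (apply `f` first). -/
def pcomp {A : Type*} (g f : List A → Option (List A)) : List A → Option (List A) :=
  fun x => (f x).bind g

/-- `h` is a right ideal morphism. -/
def IsRIM {A : Type*} (h : List A → Option (List A)) : Prop :=
  ∀ x y, h x = some y → ∀ w : List A, h (x ++ w) = some (y ++ w)

/-- Decompose a word of `{0,1,#}*` as `x # w` with `x ∈ {0,1}*`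
(splitting at the first `#`). -/
def decode3 : List Letter3 → Option (List Bool × List Letter3)
  | [] => none
  | .hash :: w => some ([], w)
  | .zero :: u => (decode3 u).map (fun p => (false :: p.1, p.2))
  | .one :: u => (decode3 u).map (fun p => (true :: p.1, p.2))

/-- The map `f ↦ f_#`: `f_#(x # w) = f(x) # w` for `x ∈ Dom(f)`, undefined elsewhere. -/
def fhash (f : List Bool → Option (List Bool)) (u : List Letter3) : Option (List Letter3) :=
  (decode3 u).bind fun p => (f p.1).map fun y => embed y ++ Letter3.hash :: p.2

theorem decode3_embed_append (x : List Bool) (w : List Letter3) :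
    decode3 (embed x ++ Letter3.hash :: w) = some (x, w) := by
  induction x with
  | nil => rfl
  | cons b x ih =>
    have ih' : decode3 (List.map (fun b => if b then Letter3.one else Letter3.zero) x ++
        Letter3.hash :: w) = some (x, w) := ih
    cases b <;> simp [embed, decode3, ih']

theorem eq_embed_append_of_decode3 {u : List Letter3} {x : List Bool} {w : List Letter3}
    (h : decode3 u = some (x, w)) : u = embed x ++ Letter3.hash :: w := by
  induction u generalizing x with
  | nil => simp [decode3] at h
  | cons a u ih =>
    cases a with
    | hash =>
      simp only [decode3, Option.some.injEq, Prod.mk.injEq] at h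
      obtain ⟨rfl, rfl⟩ := h
      rfl
    | zero | one =>
      simp only [decode3, Option.map_eq_some_iff, Prod.mk.injEq] at h
      obtain ⟨⟨x', w'⟩, hd, rfl, rfl⟩ := h
      simp [ih hd, embed]

theorem fhash_embed_append {f : List Bool → Option (List Bool)} {x y : List Bool}
    (h : f x = some y) (w : List Letter3) :
    fhash f (embed x ++ Letter3.hash :: w) = some (embed y ++ Letter3.hash :: w) := by
  simp [fhash, decode3_embed_append, h]

/-- The only preimages of `y # w` under `f_#` are the words `z # w` with `f(z) = y`. -/
theorem exists_of_fhash_eq_some {f : List Bool → Option (List Bool)} {v : List Letter3}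
    {y : List Bool} {w : List Letter3} (h : fhash f v = some (embed y ++ Letter3.hash :: w)) :
    ∃ z, f z = some y ∧ v = embed z ++ Letter3.hash :: w := by
  simp only [fhash, Option.bind_eq_some_iff, Option.map_eq_some_iff] at h
  obtain ⟨⟨z, w'⟩, hd, y', hf, he⟩ := h
  have hdec := congrArg decode3 he
  simp only [decode3_embed_append, Option.some.injEq, Prod.mk.injEq] at hdec
  obtain ⟨rfl, rfl⟩ := hdec
  exact ⟨z, hf, eq_embed_append_of_decode3 hd⟩

/-- If `G` is a right ideal morphism of `{0,1,#}*` with `f_# ∘ G ∘ f_# = f_#`,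
then there is a partial function `g` on `{0,1}*` with `f ∘ g ∘ f = f` and
`G(y # w) = g(y) # w` for all `y ∈ Im(f)` and all `w`. -/
theorem inverse_of_fhash (f : List Bool → Option (List Bool))
    (G : List Letter3 → Option (List Letter3)) (hG : IsRIM G)
    (hinv : pcomp (fhash f) (pcomp G (fhash f)) = fhash f) :
    ∃ g : List Bool → Option (List Bool),
      pcomp f (pcomp g f) = f ∧
      ∀ y, (∃ x, f x = some y) → ∃ z, g y = some z ∧
        ∀ w : List Letter3,
          G (embed y ++ Letter3.hash :: w) = some (embed z ++ Letter3.hash :: w) := by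
  have key : ∀ x y, f x = some y → ∃ z, f z = some y ∧
      G (embed y ++ [Letter3.hash]) = some (embed z ++ [Letter3.hash]) := by
    intro x y hxy
    have h := congrFun hinv (embed x ++ [Letter3.hash])
    simp only [pcomp, fhash_embed_append hxy, Option.bind_some, Option.bind_eq_some_iff] at h
    obtain ⟨v, hv, hfv⟩ := h
    obtain ⟨z, hz, rfl⟩ := exists_of_fhash_eq_some hfv
    exact ⟨z, hz, hv⟩
  refine ⟨fun y => (G (embed y ++ [Letter3.hash])).bind fun v => (decode3 v).map Prod.fst,
    ?_, ?_⟩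
  · funext x
    cases hx : f x with
    | none => simp [pcomp, hx]
    | some y =>
      obtain ⟨z, hz, hGz⟩ := key x y hx
      simp [pcomp, hx, hGz, decode3_embed_append, hz]
  · rintro y ⟨x, hx⟩
    obtain ⟨z, -, hGz⟩ := key x y hx
    refine ⟨z, by simp [hGz, decode3_embed_append], fun w => ?_⟩
    simpa using hG _ _ hGz w

end Stmt10
end

section
/- Let f be a right ideal morphism of A* such that there exist right ideal morphisms g and h of A* with g ∘ f = id_{A*} and f ∘ h = id_{A*}. Then f = id_{A*}. (Hence the monoid of right ideal morphisms of A* has trivial group of units.) -/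
namespace Stmt13

variable {A : Type*}

/-- Composition of partial functions: `pcomp g f` is `g ∘ f` (apply `f` first). -/
def pcomp (g f : List A → Option (List A)) : List A → Option (List A) :=
  fun x => (f x).bind g

/-- `h` is a right ideal morphism. -/
def IsRIM (h : List A → Option (List A)) : Prop :=
  ∀ x y, h x = some y → ∀ w : List A, h (x ++ w) = some (y ++ w)

/-- A right ideal morphism with a left inverse and a right inverse (both right
ideal morphisms) is the identity: the monoid of right ideal morphisms has a
trivial group of units. -/
theorem trivial_units (f g h : List A → Option (List A))
    (hf : IsRIM f) (hg : IsRIM g) (hh : IsRIM h)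
    (hgf : pcomp g f = fun x => some x) (hfh : pcomp f h = fun x => some x) :
    f = fun x => some x := by
  obtain ⟨u, hu, -⟩ := Option.bind_eq_some_iff.1 (congrFun hgf [])
  obtain ⟨v, -, hv⟩ := Option.bind_eq_some_iff.1 (congrFun hfh [])
  have f_eq (x : List A) : f x = some (u ++ x) := hf [] u hu x
  have u_eq : u = [] := (List.append_eq_nil_iff.1 (Option.some.inj ((f_eq v).symm.trans hv))).1
  funext x
  rw [f_eq, u_eq, List.nil_append]

end Stmt13
end

section
/- Let ℓ : {0,1}* → {0,1}* be the total function ℓ(x) = 0^{|x|} (the all-zeros word of the same length as x). If β, α : {0,1}* ⇀ {0,1}* are partial functions with β ∘ ℓ ∘ α = id_{{0,1}*}, then α admits no polynomial output bound: there is no polynomial p with natural-number coefficients such that |α(x)| ≤ p(|x|) for all x ∈ {0,1}*. In particular, α is not polynomially balanced. -/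
namespace Stmt15

/-- Composition of partial functions: `pcomp g f` is `g ∘ f` (apply `f` first). -/
def pcomp (g f : List Bool → Option (List Bool)) : List Bool → Option (List Bool) :=
  fun x => (f x).bind g

/-- The total map `ℓ(x) = 0^{|x|}`, as a partial function. -/
def ell : List Bool → Option (List Bool) :=
  fun x => some (List.replicate x.length false)

open Asymptotics Filter in
/-- A polynomial with natural-number coefficients is eventually dominated by `2 ^ n`. -/
theorem exists_eval_lt_two_pow (p : Polynomial ℕ) : ∃ n : ℕ, p.eval n < 2 ^ n := by
  have hp : (fun n : ℕ => ((p.eval n : ℕ) : ℝ)) =o[atTop] fun n : ℕ => (2 : ℝ) ^ n := by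
    induction p using Polynomial.induction_on' with
    | add p q hp hq => simpa using hp.add hq
    | monomial k a =>
      simpa using
        (isLittleO_pow_const_const_pow_of_one_lt k (one_lt_two (α := ℝ))).const_mul_left (a : ℝ)
  obtain ⟨n, hn⟩ := (hp.def (one_half_pos (α := ℝ))).exists
  refine ⟨n, ?_⟩
  have hpos : (0 : ℝ) < 2 ^ n := by positivity
  rw [Real.norm_of_nonneg (Nat.cast_nonneg _), Real.norm_of_nonneg hpos.le] at hn
  have hlt : ((p.eval n : ℕ) : ℝ) < 2 ^ n := by linarith
  exact_mod_cast hlt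

/-- If `β ∘ ℓ ∘ α = id`, then `α` is total and `β` recovers `x` from the length of `α x`. -/
theorem exists_apply_replicate_eq {α β : List Bool → Option (List Bool)}
    (h : pcomp β (pcomp ell α) = fun x => some x) (x : List Bool) :
    ∃ y, α x = some y ∧ β (List.replicate y.length false) = some x := by
  have hx := congrFun h x
  cases hα : α x with
  | none => simp [pcomp, hα] at hx
  | some y => exact ⟨y, rfl, by simpa [pcomp, ell, hα] using hx⟩

/-- If `β ∘ ℓ ∘ α = id` on `{0,1}*`, where `ℓ(x) = 0^{|x|}`, then `α` admits no
polynomial output bound (in particular `α` is not polynomially balanced). -/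
theorem no_polynomial_bound (α β : List Bool → Option (List Bool))
    (h : pcomp β (pcomp ell α) = fun x => some x) :
    ¬ ∃ p : Polynomial ℕ, ∀ x y, α x = some y → y.length ≤ p.eval x.length := by
  rintro ⟨p, hp⟩
  choose f hα hβ using exists_apply_replicate_eq h
  obtain ⟨n, hn⟩ := exists_eval_lt_two_pow (p + 1)
  let g : List.Vector Bool n → Fin (p.eval n + 1) := fun v =>
    ⟨(f v.1).length, Nat.lt_succ_of_le (by simpa [v.2] using hp v.1 _ (hα v.1))⟩
  have hg : Function.Injective g := fun v w hvw => by
    have hlen : (f v.1).length = (f w.1).length := congrArg Fin.val hvw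
    have hv := hβ v.1
    rw [hlen, hβ w.1] at hv
    exact Subtype.ext (Option.some.inj hv).symm
  have hcard := Fintype.card_le_of_injective g hg
  simp only [card_vector, Fintype.card_bool, Fintype.card_fin] at hcard
  simp only [Polynomial.eval_add, Polynomial.eval_one] at hn
  exact absurd hn hcard.not_gt

end Stmt15
end

section
/- Let M be a monoid and let f, g, α, β ∈ M satisfy f = g·α and g = f·β (so f and g are R-equivalent in Green's relations, with the witnessing multipliers α and β). Then for every f' ∈ M with f·f'·f = f, the element α·f' is an inverse of g, i.e., g·(α·f')·g = g. Consequently, R-equivalent elements of M are equivalent under inversive reduction (with simulation given by two-sided multiplication in M), so Green's D-relation refines ≡_inv. -/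
namespace Stmt19

variable {M : Type*} [Monoid M]

/-- Simulation in a monoid: `f ≼ g` iff `f = β·g·α` for some `β, α ∈ M`. -/
def Sim (f g : M) : Prop := ∃ β α : M, f = β * g * α

/-- An inverse of `g * α` yields an inverse of `g`, provided `g` is a right multiple of `g * α`. -/
theorem inverse_of_R_equiv {f g α β : M} (h₁ : f = g * α) (h₂ : g = f * β) {f' : M}
    (hf : f * f' * f = f) : g * (α * f') * g = g :=
  calc g * (α * f') * g = g * α * f' * (f * β) := by rw [← h₂, ← mul_assoc g]
    _ = f * f' * f * β := by rw [← h₁, mul_assoc (f * f')]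
    _ = g := by rw [hf, ← h₂]

/-- If `f = g·α` and `g = f·β` (so `f R g` in Green's relations), then for every
inverse `f'` of `f`, the element `α·f'` is an inverse of `g`; consequently `f`
and `g` are equivalent under inversive reduction. -/
theorem R_equiv_inversive (f g α β : M) (h₁ : f = g * α) (h₂ : g = f * β) :
    (∀ f', f * f' * f = f → g * (α * f') * g = g) ∧
    Sim f g ∧ Sim g f ∧
    (∀ g', g * g' * g = g → ∃ f', f * f' * f = f ∧ Sim f' g') ∧
    (∀ f', f * f' * f = f → ∃ g', g * g' * g = g ∧ Sim g' f') := by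
  refine ⟨fun f' hf => inverse_of_R_equiv h₁ h₂ hf, ⟨1, α, by rw [one_mul, h₁]⟩,
    ⟨1, β, by rw [one_mul, ← h₂]⟩, fun g' hg => ?_, fun f' hf => ?_⟩
  · exact ⟨β * g', inverse_of_R_equiv h₂ h₁ hg, β, 1, (mul_one _).symm⟩
  · exact ⟨α * f', inverse_of_R_equiv h₁ h₂ hf, α, 1, (mul_one _).symm⟩

end Stmt19
end
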